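/- arXiv:1709.08083 — 6 statements merged into one kernel-verified Lean document; each statement's English description precedes it below -/
import Mathlib

section
/- Let G_p be a theme network and α ≥ 0. If C1 and C2 are pattern trusses with respect to α in G_p, then the edge-induced subgraph of G_p on the union of their edge sets is also a pattern truss with respect to α. -/
open Finset

attribute [local instance] Classical.propDecidable

variable {V S : Type*}

/-- The frequency of pattern `p` in transaction database `d`. -/
noncomputable def freqIn [DecidableEq S] (d : Multiset (Finset S)) (p : Finset S) : ℚ :=
  ((d.filter (fun t => p ⊆ t)).card : ℚ) / (d.card : ℚ)

/-- Vertex set of the theme network `G_p`: vertices with positive frequency of `p`. -/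
noncomputable def themeVerts [Fintype V] [DecidableEq S]
    (db : V → Multiset (Finset S)) (p : Finset S) : Finset V :=
  univ.filter (fun v => 0 < freqIn (db v) p)

/-- Edge set of the theme network `G_p`: edges of `G` both of whose endpoints have
positive frequency of `p`. -/
noncomputable def themeEdges [Fintype V] [DecidableEq V] [DecidableEq S]
    (G : SimpleGraph V) [DecidableRel G.Adj]
    (db : V → Multiset (Finset S)) (p : Finset S) : Finset (Sym2 V) :=
  G.edgeFinset.filter (fun e => ∀ v ∈ e, 0 < freqIn (db v) p)

/-- Vertices of the edge-induced subgraph with edge set `E'`. -/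
noncomputable def edgeVerts [Fintype V] [DecidableEq V] (E' : Finset (Sym2 V)) : Finset V :=
  univ.filter (fun v => ∃ e ∈ E', v ∈ e)

/-- Edge cohesion of the edge `(i, j)` in the edge-induced subgraph with edge set `E'`,
with vertex frequencies `f`: the sum over triangles containing the edge of the minimum
frequency of the three vertices of the triangle. -/
noncomputable def eco [Fintype V] [DecidableEq V]
    (E' : Finset (Sym2 V)) (f : V → ℚ) (i j : V) : ℚ :=
  ∑ k ∈ univ.filter (fun k => k ≠ i ∧ k ≠ j ∧ s(i, k) ∈ E' ∧ s(j, k) ∈ E'),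
    min (f i) (min (f j) (f k))

/-- A pattern truss w.r.t. threshold `α`: an edge-induced subgraph of the theme network
`G_p` each of whose edges has cohesion greater than `α`. -/
def IsPatternTruss [Fintype V] [DecidableEq V] [DecidableEq S]
    (G : SimpleGraph V) [DecidableRel G.Adj]
    (db : V → Multiset (Finset S)) (p : Finset S) (α : ℚ)
    (E' : Finset (Sym2 V)) : Prop :=
  E' ⊆ themeEdges G db p ∧
  ∀ i j : V, s(i, j) ∈ E' → α < eco E' (fun v => freqIn (db v) p) i j

/-- The (edge set of the) maximal pattern truss `C*_p(α)`: the union of all pattern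
trusses with respect to `α` in `G_p`. -/
noncomputable def maxTruss [Fintype V] [DecidableEq V] [DecidableEq S]
    (G : SimpleGraph V) [DecidableRel G.Adj]
    (db : V → Multiset (Finset S)) (p : Finset S) (α : ℚ) : Finset (Sym2 V) :=
  univ.filter (fun e => ∃ E' : Finset (Sym2 V), IsPatternTruss G db p α E' ∧ e ∈ E')

theorem eco_mono_aux [Fintype V] [DecidableEq V] (A B : Finset (Sym2 V)) (hAB : A ⊆ B)
    (f : V → ℚ) (hf : ∀ v, 0 ≤ f v) (i j : V) : eco A f i j ≤ eco B f i j := by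
  unfold eco
  apply Finset.sum_le_sum_of_subset_of_nonneg
  · intro k hk
    simp only [Finset.mem_filter, Finset.mem_univ, true_and] at hk ⊢
    exact ⟨hk.1, hk.2.1, hAB hk.2.2.1, hAB hk.2.2.2⟩
  · intro k _ _
    exact le_min (hf i) (le_min (hf j) (hf k))

/-- The union of two pattern trusses with respect to `α` in `G_p` is again a pattern
truss with respect to `α`. -/
theorem union_isPatternTruss [Fintype V] [DecidableEq V] [DecidableEq S]
    (G : SimpleGraph V) [DecidableRel G.Adj]
    (db : V → Multiset (Finset S)) (hdb : ∀ v, db v ≠ 0)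
    (p : Finset S) (α : ℚ) (hα : 0 ≤ α)
    (E1 E2 : Finset (Sym2 V))
    (h1 : IsPatternTruss G db p α E1) (h2 : IsPatternTruss G db p α E2) :
    IsPatternTruss G db p α (E1 ∪ E2) := by
  have hf : ∀ v, 0 ≤ freqIn (db v) p := fun v => by unfold freqIn; positivity
  refine ⟨Finset.union_subset h1.1 h2.1, fun i j h => ?_⟩
  rcases Finset.mem_union.1 h with h | h
  · exact (h1.2 i j h).trans_le (eco_mono_aux _ _ Finset.subset_union_left _ hf i j)
  · exact (h2.2 i j h).trans_le (eco_mono_aux _ _ Finset.subset_union_right _ hf i j)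
end

section
/- Let G_p be a theme network and α ≥ 0. The edge-induced subgraph of G_p on the union of the edge sets of all pattern trusses with respect to α in G_p is itself a pattern truss with respect to α; consequently it is the unique maximal pattern truss C*_p(α) in G_p: it is a pattern truss with respect to α that contains every pattern truss with respect to α in G_p. -/
open Finset

attribute [local instance] Classical.propDecidable

variable {V S : Type*}

/-- The union of all pattern trusses with respect to `α` in `G_p` is itself a pattern
truss with respect to `α`; consequently it is the unique maximal pattern truss
`C*_p(α)`: a pattern truss with respect to `α` containing every pattern truss with
respect to `α` in `G_p`. -/
theorem maxTruss_spec [Fintype V] [DecidableEq V] [DecidableEq S]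
    (G : SimpleGraph V) [DecidableRel G.Adj]
    (db : V → Multiset (Finset S)) (hdb : ∀ v, db v ≠ 0)
    (p : Finset S) (α : ℚ) (hα : 0 ≤ α) :
    IsPatternTruss G db p α (maxTruss G db p α) ∧
    (∀ E' : Finset (Sym2 V), IsPatternTruss G db p α E' → E' ⊆ maxTruss G db p α) ∧
    (∀ M : Finset (Sym2 V), IsPatternTruss G db p α M →
      (∀ E' : Finset (Sym2 V), IsPatternTruss G db p α E' → E' ⊆ M) →
      M = maxTruss G db p α) := by
  have hsub : ∀ E' : Finset (Sym2 V), IsPatternTruss G db p α E' → E' ⊆ maxTruss G db p α := by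
    intro E' hE e he
    simp only [maxTruss, mem_filter, mem_univ, true_and]
    exact ⟨E', hE, he⟩
  have hf : ∀ v, 0 ≤ freqIn (db v) p := by
    intro v
    unfold freqIn
    positivity
  have hmax : IsPatternTruss G db p α (maxTruss G db p α) := by
    refine ⟨?_, ?_⟩
    · intro e he
      simp only [maxTruss, mem_filter, mem_univ, true_and] at he
      obtain ⟨E', hE, he⟩ := he
      exact hE.1 he
    · intro i j he
      have he' := he
      simp only [maxTruss, mem_filter, mem_univ, true_and] at he'
      obtain ⟨E', hE, h⟩ := he'
      refine lt_of_lt_of_le (hE.2 i j h) ?_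
      unfold eco
      apply Finset.sum_le_sum_of_subset_of_nonneg
      · intro k hk
        simp only [mem_filter, mem_univ, true_and] at hk ⊢
        exact ⟨hk.1, hk.2.1, hsub E' hE hk.2.2.1, hsub E' hE hk.2.2.2⟩
      · intro k _ _
        exact le_min (hf i) (le_min (hf j) (hf k))
  exact ⟨hmax, hsub, fun M hM h => Finset.Subset.antisymm (hsub M hM) (h _ hmax)⟩
end

section
/- (Graph anti-monotonicity.) Let G be a database network, α ≥ 0, and let p1 ⊆ p2 ⊆ S be patterns. Then the maximal pattern truss with respect to α in the theme network G_{p2} is contained in the maximal pattern truss with respect to α in the theme network G_{p1}; that is, C*_{p2}(α) ⊆ C*_{p1}(α) (both as vertex sets and as edge sets). -/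
open Finset

attribute [local instance] Classical.propDecidable

variable {V S : Type*}

theorem freqIn_anti_aux [DecidableEq S] (d : Multiset (Finset S)) {p1 p2 : Finset S}
    (h : p1 ⊆ p2) : freqIn d p2 ≤ freqIn d p1 := by
  unfold freqIn
  apply div_le_div_of_nonneg_right _ (Nat.cast_nonneg _)
  exact_mod_cast Multiset.card_le_card
    (Multiset.monotone_filter_right d (fun t ht => h.trans ht))

/-- Graph anti-monotonicity: if `p1 ⊆ p2`, then the maximal pattern truss of `G_{p2}`
is contained in the maximal pattern truss of `G_{p1}`, both as edge sets and as vertex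
sets. -/
theorem maxTruss_graph_anti_monotone [Fintype V] [DecidableEq V] [DecidableEq S]
    (G : SimpleGraph V) [DecidableRel G.Adj]
    (db : V → Multiset (Finset S)) (hdb : ∀ v, db v ≠ 0)
    (α : ℚ) (hα : 0 ≤ α)
    (p1 p2 : Finset S) (h12 : p1 ⊆ p2) :
    maxTruss G db p2 α ⊆ maxTruss G db p1 α ∧
    edgeVerts (V := V) (maxTruss G db p2 α) ⊆ edgeVerts (maxTruss G db p1 α) := by
  have key : maxTruss G db p2 α ⊆ maxTruss G db p1 α := by
    intro e he
    simp only [maxTruss, mem_filter, mem_univ, true_and] at he ⊢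
    obtain ⟨E', ⟨hsub, hco⟩, heE⟩ := he
    refine ⟨E', ⟨?_, ?_⟩, heE⟩
    · intro x hx
      have := hsub hx
      simp only [themeEdges, mem_filter] at this ⊢
      exact ⟨this.1, fun v hv => (this.2 v hv).trans_le (freqIn_anti_aux _ h12)⟩
    · intro i j hij
      refine (hco i j hij).trans_le ?_
      unfold eco
      apply Finset.sum_le_sum
      intro k _
      exact min_le_min (freqIn_anti_aux _ h12)
        (min_le_min (freqIn_anti_aux _ h12) (freqIn_anti_aux _ h12))
  refine ⟨key, ?_⟩
  intro v hv
  simp only [edgeVerts, mem_filter, mem_univ, true_and] at hv ⊢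
  obtain ⟨e, he, hve⟩ := hv
  exact ⟨e, key he, hve⟩
end

section
/- (Graph intersection property.) Let G be a database network, α ≥ 0, and let p1, p2, p3 ⊆ S be patterns with p1 ⊆ p3 and p2 ⊆ p3. Then the maximal pattern truss C*_{p3}(α) is contained in the intersection C*_{p1}(α) ∩ C*_{p2}(α) of the maximal pattern trusses for p1 and p2 (inclusion of both vertex sets and edge sets). -/
open Finset

attribute [local instance] Classical.propDecidable

variable {V S : Type*}

theorem freqIn_anti [DecidableEq S] (d : Multiset (Finset S)) {p q : Finset S} (h : p ⊆ q) :
    freqIn d q ≤ freqIn d p := by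
  unfold freqIn
  gcongr
  exact Multiset.monotone_filter_right d (fun t ht => h.trans ht)

theorem maxTruss_anti [Fintype V] [DecidableEq V] [DecidableEq S]
    (G : SimpleGraph V) [DecidableRel G.Adj]
    (db : V → Multiset (Finset S)) (α : ℚ) {p q : Finset S} (h : p ⊆ q) :
    maxTruss G db q α ⊆ maxTruss G db p α := by
  intro e he
  simp only [maxTruss, Finset.mem_filter, Finset.mem_univ, true_and] at he ⊢
  obtain ⟨E', ⟨h1, h2⟩, he⟩ := he
  refine ⟨E', ⟨?_, ?_⟩, he⟩
  · intro x hx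
    have := h1 hx
    simp only [themeEdges, Finset.mem_filter] at this ⊢
    exact ⟨this.1, fun v hv => (this.2 v hv).trans_le (freqIn_anti _ h)⟩
  · intro i j hij
    refine (h2 i j hij).trans_le ?_
    unfold eco
    refine Finset.sum_le_sum fun k _ => ?_
    exact min_le_min (freqIn_anti _ h) (min_le_min (freqIn_anti _ h) (freqIn_anti _ h))

theorem edgeVerts_mono [Fintype V] [DecidableEq V] {A B : Finset (Sym2 V)} (h : A ⊆ B) :
    edgeVerts A ⊆ edgeVerts B := by
  intro v hv
  simp only [edgeVerts, Finset.mem_filter, Finset.mem_univ, true_and] at hv ⊢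
  obtain ⟨e, he, hv⟩ := hv
  exact ⟨e, h he, hv⟩

/-- Graph intersection property: if `p1 ⊆ p3` and `p2 ⊆ p3`, then the maximal pattern
truss `C*_{p3}(α)` is contained in the intersection `C*_{p1}(α) ∩ C*_{p2}(α)`, both as
edge sets and as vertex sets. -/
theorem maxTruss_intersection [Fintype V] [DecidableEq V] [DecidableEq S]
    (G : SimpleGraph V) [DecidableRel G.Adj]
    (db : V → Multiset (Finset S)) (hdb : ∀ v, db v ≠ 0)
    (α : ℚ) (hα : 0 ≤ α)
    (p1 p2 p3 : Finset S) (h13 : p1 ⊆ p3) (h23 : p2 ⊆ p3) :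
    maxTruss G db p3 α ⊆ maxTruss G db p1 α ∩ maxTruss G db p2 α ∧
    edgeVerts (V := V) (maxTruss G db p3 α) ⊆
      edgeVerts (maxTruss G db p1 α) ∩ edgeVerts (maxTruss G db p2 α) := by
  have a := maxTruss_anti G db α h13
  have b := maxTruss_anti G db α h23
  exact ⟨Finset.subset_inter a b,
    Finset.subset_inter (edgeVerts_mono a) (edgeVerts_mono b)⟩
end

section
/- Let G_p be a theme network, let α1 ≥ 0 be such that the maximal pattern truss C*_p(α1) is nonempty, and let β = min over edges e_ij ∈ E*_p(α1) of eco_ij(C*_p(α1)) be its minimum edge cohesion. Then for every α2 with α1 ≤ α2 < β, the maximal pattern trusses coincide: C*_p(α2) = C*_p(α1); that is, the maximal pattern truss changes only when the threshold reaches the minimum edge cohesion. -/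
open Finset

attribute [local instance] Classical.propDecidable

variable {V S : Type*}

/-- If `C*_p(α1)` is nonempty with minimum edge cohesion `β`, then for every `α2` with
`α1 ≤ α2 < β` the maximal pattern trusses coincide: `C*_p(α2) = C*_p(α1)`. -/
theorem maxTruss_stable_below_min_eco [Fintype V] [DecidableEq V] [DecidableEq S]
    (G : SimpleGraph V) [DecidableRel G.Adj]
    (db : V → Multiset (Finset S)) (hdb : ∀ v, db v ≠ 0)
    (p : Finset S) (α1 : ℚ) (hα1 : 0 ≤ α1)
    (hne : maxTruss G db p α1 ≠ ∅)
    (β : ℚ)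
    (hβ_le : ∀ i j : V, s(i, j) ∈ maxTruss G db p α1 →
      β ≤ eco (maxTruss G db p α1) (fun v => freqIn (db v) p) i j)
    (hβ_mem : ∃ i j : V, s(i, j) ∈ maxTruss G db p α1 ∧
      eco (maxTruss G db p α1) (fun v => freqIn (db v) p) i j = β) :
    ∀ α2 : ℚ, α1 ≤ α2 → α2 < β → maxTruss G db p α2 = maxTruss G db p α1 := by
  intro α2 h12 h2
  ext e
  constructor
  · intro he
    simp only [maxTruss, Finset.mem_filter, Finset.mem_univ, true_and] at he ⊢
    obtain ⟨E', hE, hmem⟩ := he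
    exact ⟨E', ⟨hE.1, fun i j h => lt_of_le_of_lt h12 (hE.2 i j h)⟩, hmem⟩
  · intro he
    have hT : IsPatternTruss G db p α2 (maxTruss G db p α1) := by
      refine ⟨?_, fun i j h => lt_of_lt_of_le h2 (hβ_le i j h)⟩
      intro x hx
      simp only [maxTruss, Finset.mem_filter, Finset.mem_univ, true_and] at hx
      obtain ⟨E', hE, hmem⟩ := hx
      exact hE.1 hmem
    rw [maxTruss, Finset.mem_filter]
    exact ⟨Finset.mem_univ _, _, hT, he⟩
end

section
/- (Core of the #P-hardness reduction.) Let d be a nonempty finite transaction database over item set S, and let G be the database network on three vertices v1, v2, v3 forming a triangle (all three edges present), with d1 = d2 = d3 = d. Then for every pattern p ⊆ S with f(p) > 0, the theme network G_p is the whole triangle, the edge cohesion of each of its three edges in G_p equals f(p), and for any threshold α ∈ [0,1]: the maximal pattern truss C*_p(α) equals the whole triangle if f(p) > α, and C*_p(α) = ∅ if f(p) ≤ α. Consequently the number of patterns p ⊆ S for which G contains a nonempty theme community with theme p equals the number of patterns p with f(p) > α. -/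
open Finset

attribute [local instance] Classical.propDecidable

variable {V S : Type*}

lemma mem_themeEdges_aux [Fintype V] [DecidableEq V] [DecidableEq S]
    (G : SimpleGraph V) [DecidableRel G.Adj]
    (db : V → Multiset (Finset S)) (p : Finset S) (e : Sym2 V) :
    e ∈ themeEdges G db p ↔ e ∈ G.edgeFinset ∧ ∀ v ∈ e, 0 < freqIn (db v) p := by
  unfold themeEdges
  exact Finset.mem_filter

lemma eco_aux_le (E' : Finset (Sym2 (Fin 3))) (c : ℚ) (hc : 0 ≤ c) (i j : Fin 3) (hij : i ≠ j) :
    eco E' (fun _ => c) i j ≤ c := by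
  unfold eco
  simp only [min_self, sum_const, nsmul_eq_mul]
  have h : (univ.filter (fun k => k ≠ i ∧ k ≠ j ∧ s(i, k) ∈ E' ∧ s(j, k) ∈ E')).card ≤ 1 := by
    rw [Finset.card_le_one]
    intro a ha b hb
    simp only [mem_filter, mem_univ, true_and] at ha hb
    omega
  have h' : ((univ.filter (fun k => k ≠ i ∧ k ≠ j ∧ s(i, k) ∈ E' ∧ s(j, k) ∈ E')).card : ℚ) ≤ 1 := by
    exact_mod_cast h
  nlinarith

lemma eco_aux_ge (E' : Finset (Sym2 (Fin 3))) (hE : ∀ a b : Fin 3, a ≠ b → s(a, b) ∈ E')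
    (c : ℚ) (hc : 0 ≤ c) (i j : Fin 3) :
    c ≤ eco E' (fun _ => c) i j := by
  unfold eco
  simp only [min_self, sum_const, nsmul_eq_mul]
  have h : 1 ≤ (univ.filter (fun k => k ≠ i ∧ k ≠ j ∧ s(i, k) ∈ E' ∧ s(j, k) ∈ E')).card := by
    rw [Nat.one_le_iff_ne_zero, ← Nat.pos_iff_ne_zero, Finset.card_pos]
    have : ∀ i j : Fin 3, ∃ k, k ≠ i ∧ k ≠ j := by decide
    obtain ⟨k, h1, h2⟩ := this i j
    exact ⟨k, by simp [h1, h2, hE i k h1.symm, hE j k h2.symm]⟩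
  have h' : (1 : ℚ) ≤ ((univ.filter (fun k => k ≠ i ∧ k ≠ j ∧ s(i, k) ∈ E' ∧ s(j, k) ∈ E')).card : ℚ) := by
    exact_mod_cast h
  nlinarith

/-- Core of the #P-hardness reduction: let `d` be a nonempty transaction database over
the finite item set `S`, and let `G` be the database network on three vertices forming
a triangle, each vertex carrying a copy of `d`. Then for every pattern `p` with
`f(p) > 0` the theme network `G_p` is the whole triangle, the cohesion of each of its
edges equals `f(p)`, and for `α ∈ [0,1]` the maximal pattern truss `C*_p(α)` is the
whole triangle if `f(p) > α` and empty if `f(p) ≤ α`. Consequently the number of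
patterns `p ⊆ S` for which `G` contains a nonempty theme community with theme `p`
equals the number of patterns with `f(p) > α`. -/
theorem triangle_reduction [DecidableEq S] [Fintype S]
    (d : Multiset (Finset S)) (hd : d ≠ 0)
    (db : Fin 3 → Multiset (Finset S)) (hdb : ∀ v, db v = d)
    (α : ℚ) (hα0 : 0 ≤ α) (hα1 : α ≤ 1) :
    (∀ p : Finset S, 0 < freqIn d p →
      themeEdges (⊤ : SimpleGraph (Fin 3)) db p = (⊤ : SimpleGraph (Fin 3)).edgeFinset ∧
      (∀ i j : Fin 3, s(i, j) ∈ themeEdges (⊤ : SimpleGraph (Fin 3)) db p →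
        eco (themeEdges (⊤ : SimpleGraph (Fin 3)) db p)
          (fun v => freqIn (db v) p) i j = freqIn d p) ∧
      (α < freqIn d p →
        maxTruss (⊤ : SimpleGraph (Fin 3)) db p α = (⊤ : SimpleGraph (Fin 3)).edgeFinset) ∧
      (freqIn d p ≤ α → maxTruss (⊤ : SimpleGraph (Fin 3)) db p α = ∅)) ∧
    ((univ : Finset (Finset S)).filter
        (fun p => maxTruss (⊤ : SimpleGraph (Fin 3)) db p α ≠ ∅)).card =
      ((univ : Finset (Finset S)).filter (fun p => α < freqIn d p)).card := by
  obtain rfl : db = fun _ => d := funext hdb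
  have hnn : ∀ p, 0 ≤ freqIn d p := fun p => by unfold freqIn; positivity
  have hE : ∀ p, 0 < freqIn d p →
      themeEdges (⊤ : SimpleGraph (Fin 3)) (fun _ => d) p = (⊤ : SimpleGraph (Fin 3)).edgeFinset := by
    intro p hp
    ext e
    rw [mem_themeEdges_aux]
    exact ⟨fun h => h.1, fun h => ⟨h, fun _ _ => hp⟩⟩
  have hne : ∀ p (i j : Fin 3), s(i, j) ∈ themeEdges (⊤ : SimpleGraph (Fin 3)) (fun _ => d) p →
      i ≠ j := by
    intro p i j h
    have h2 := ((mem_themeEdges_aux _ _ _ _).mp h).1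
    rw [SimpleGraph.mem_edgeFinset, SimpleGraph.mem_edgeSet] at h2
    exact h2.ne
  have hin : ∀ a b : Fin 3, a ≠ b → s(a, b) ∈ (⊤ : SimpleGraph (Fin 3)).edgeFinset := by
    intro a b h
    rw [SimpleGraph.mem_edgeFinset, SimpleGraph.mem_edgeSet]
    exact h
  have h3 : ∀ p, α < freqIn d p →
      maxTruss (⊤ : SimpleGraph (Fin 3)) (fun _ => d) p α = (⊤ : SimpleGraph (Fin 3)).edgeFinset := by
    intro p hp
    have hp0 := lt_of_le_of_lt hα0 hp
    ext e
    unfold maxTruss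
    rw [Finset.mem_filter]
    constructor
    · rintro ⟨-, E', hT, he⟩
      have := hT.1 he
      rwa [hE p hp0] at this
    · intro he
      refine ⟨mem_univ _, _, ⟨(hE p hp0).ge, ?_⟩, he⟩
      intro i j _
      exact lt_of_lt_of_le hp (eco_aux_ge _ hin _ hp0.le i j)
  have h4 : ∀ p, freqIn d p ≤ α → maxTruss (⊤ : SimpleGraph (Fin 3)) (fun _ => d) p α = ∅ := by
    intro p hp
    rw [Finset.eq_empty_iff_forall_notMem]
    intro e he
    obtain ⟨-, E', hT, he⟩ := Finset.mem_filter.mp he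
    induction e using Sym2.ind with
    | _ i j =>
      have h1 := hT.2 i j he
      have h2 := eco_aux_le E' _ (hnn p) i j (hne p i j (hT.1 he))
      exact absurd (lt_of_lt_of_le h1 h2) (not_lt.mpr hp)
  refine ⟨fun p hp => ⟨hE p hp, ?_, h3 p, h4 p⟩, ?_⟩
  · intro i j hij
    refine le_antisymm (eco_aux_le _ _ (hnn p) i j (hne p i j hij)) (eco_aux_ge _ ?_ _ (hnn p) i j)
    rw [hE p hp]
    exact hin
  · congr 1
    ext p
    simp only [Finset.mem_filter, mem_univ, true_and]
    constructor
    · intro h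
      by_contra h'
      exact h (h4 p (not_lt.mp h'))
    · intro h h'
      have := hin 0 1 (by decide)
      rw [← h3 p h, h'] at this
      exact absurd this (Finset.notMem_empty _)
end
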